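/- arXiv:1407.3642 — 2 statements merged into one kernel-verified Lean document; each statement's English description precedes it below -/
import Mathlib

section
/- For all indices i, j, k ∈ {1,…,N}, the triple commutator satisfies [A_i, [A_j, A_k]] = n(i) · P³ · ( n(k)·e_jᵀ − n(j)·e_kᵀ )·n, where [X,Y] = X·Y − Y·X and (n(k)·e_jᵀ − n(j)·e_kᵀ)·n is the rank-one matrix with (r,s) entry (n(k)·e_j(r) − n(j)·e_k(r))·n(s). -/
open Matrix

/-- `T k = n(k)•𝟙 − eₖᵀ·n`, where `eₖᵀ·n` is the rank-one matrix with `(i,j)` entry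
`eₖ(i)·n(j)`. -/
def Tmat {𝕜 : Type*} [RCLike 𝕜] {N : ℕ} (n : Fin N → 𝕜) (k : Fin N) :
    Matrix (Fin N) (Fin N) 𝕜 :=
  n k • (1 : Matrix (Fin N) (Fin N) 𝕜) - Matrix.vecMulVec (Pi.single k 1) n

/-- `A k = P·(T k)`. -/
def Amat {𝕜 : Type*} [RCLike 𝕜] {N : ℕ} (P : Matrix (Fin N) (Fin N) 𝕜)
    (n : Fin N → 𝕜) (k : Fin N) : Matrix (Fin N) (Fin N) 𝕜 :=
  P * Tmat n k

theorem Tmat_mul_of_vecMul_eq_zero {𝕜 : Type*} [RCLike 𝕜] {N : ℕ}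
    {P : Matrix (Fin N) (Fin N) 𝕜} {n : Fin N → 𝕜} (hn : Matrix.vecMul n P = 0) (k : Fin N) :
    Tmat n k * P = n k • P := by
  simp [Tmat, sub_mul, Matrix.vecMulVec_mul, hn]

theorem Amat_mul_Amat {𝕜 : Type*} [RCLike 𝕜] {N : ℕ}
    {P : Matrix (Fin N) (Fin N) 𝕜} {n : Fin N → 𝕜} (hn : Matrix.vecMul n P = 0) (j k : Fin N) :
    Amat P n j * Amat P n k = n j • (P ^ 2 * Tmat n k) := by
  rw [Amat, Amat, mul_assoc, ← mul_assoc (Tmat n j), Tmat_mul_of_vecMul_eq_zero hn,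
    smul_mul_assoc, mul_smul_comm, ← mul_assoc, sq]

theorem Amat_commutator {𝕜 : Type*} [RCLike 𝕜] {N : ℕ}
    {P : Matrix (Fin N) (Fin N) 𝕜} {n : Fin N → 𝕜} (hn : Matrix.vecMul n P = 0) (j k : Fin N) :
    Amat P n j * Amat P n k - Amat P n k * Amat P n j =
      P ^ 2 * Matrix.vecMulVec
        (n k • (Pi.single j 1 : Fin N → 𝕜) - n j • (Pi.single k 1 : Fin N → 𝕜)) n := by
  rw [Amat_mul_Amat hn, Amat_mul_Amat hn, ← mul_smul_comm, ← mul_smul_comm, ← mul_sub]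
  congr 1
  simp only [Tmat, Matrix.sub_vecMulVec, Matrix.smul_vecMulVec, smul_sub,
    smul_comm (n j) (n k) (1 : Matrix (Fin N) (Fin N) 𝕜)]
  abel

/-- `[A i, [A j, A k]] = n i • (P³ * ((n k • eⱼᵀ − n j • eₖᵀ)·n))`. -/
theorem stmt4 {𝕜 : Type*} [RCLike 𝕜] {N : ℕ} (P : Matrix (Fin N) (Fin N) 𝕜)
    (n : Fin N → 𝕜) (hn : Matrix.vecMul n P = 0) (i j k : Fin N) :
    Amat P n i * (Amat P n j * Amat P n k - Amat P n k * Amat P n j) -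
        (Amat P n j * Amat P n k - Amat P n k * Amat P n j) * Amat P n i =
      n i • (P ^ 3 * Matrix.vecMulVec (n k • (Pi.single j 1 : Fin N → 𝕜) - n j • (Pi.single k 1 : Fin N → 𝕜)) n) := by
  have h_right (v : Fin N → 𝕜) : Matrix.vecMulVec v n * Amat P n i = 0 := by
    rw [Amat, ← mul_assoc, Matrix.vecMulVec_mul, hn, Matrix.vecMulVec_zero, zero_mul]
  rw [Amat_commutator hn, mul_assoc (P ^ 2), h_right, mul_zero, sub_zero, Amat, sq]
  simp only [mul_assoc]
  rw [← mul_assoc (Tmat n i), Tmat_mul_of_vecMul_eq_zero hn, smul_mul_assoc, mul_smul_comm]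
  simp only [pow_succ, pow_zero, one_mul, mul_assoc]
end

section
/- If P is strictly upper triangular (P(i,j) = 0 whenever i ≥ j), then for every L ≥ 0 with L + 2 ≥ N and all indices i_1,…,i_L, j, k ∈ {1,…,N}, the nested commutator [A_{i_L}, […, [A_{i_1}, [A_j, A_k]]…]] = 0; in particular the lower central series of the matrix family terminates. -/
open Matrix

/-- Nested commutator `[A i_L, [⋯, [A i_1, X]⋯]]` for `is = [i_1, …, i_L]`,
with `[X,Y] = X·Y − Y·X`. -/
def nestedComm {𝕜 : Type*} [RCLike 𝕜] {N : ℕ} (A : Fin N → Matrix (Fin N) (Fin N) 𝕜)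
    (is : List (Fin N)) (X : Matrix (Fin N) (Fin N) 𝕜) : Matrix (Fin N) (Fin N) 𝕜 :=
  is.foldl (fun Y i => A i * Y - Y * A i) X

/-- The entries of the `m`-th power of a strictly upper triangular matrix vanish
below the `m`-th superdiagonal. -/
theorem pow_apply_eq_zero_of_strictUpper {R : Type*} [Semiring R] {N : ℕ}
    {P : Matrix (Fin N) (Fin N) R} (hP : ∀ i j : Fin N, j ≤ i → P i j = 0) (m : ℕ)
    (i j : Fin N) (h : (j : ℕ) < i + m) : (P ^ m) i j = 0 := by
  induction m generalizing j with
  | zero =>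
    rw [pow_zero, Matrix.one_apply_ne]
    rintro rfl
    omega
  | succ m ih =>
    rw [pow_succ, Matrix.mul_apply]
    refine Finset.sum_eq_zero fun l _ => ?_
    by_cases hl : (l : ℕ) < i + m
    · rw [ih l hl, zero_mul]
    · rw [hP l j (Fin.le_def.2 (by omega)), mul_zero]

/-- A strictly upper triangular matrix of size `N` is nilpotent of index at most `N`. -/
theorem pow_eq_zero_of_strictUpper {R : Type*} [Semiring R] {N : ℕ}
    {P : Matrix (Fin N) (Fin N) R} (hP : ∀ i j : Fin N, j ≤ i → P i j = 0) {m : ℕ}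
    (hm : N ≤ m) : P ^ m = 0 := by
  ext i j
  exact pow_apply_eq_zero_of_strictUpper hP m i j (by omega)

section

variable {𝕜 : Type*} [RCLike 𝕜] {N : ℕ} {P : Matrix (Fin N) (Fin N) 𝕜} {n : Fin N → 𝕜}

theorem Amat_eq (k : Fin N) :
    Amat P n k = n k • P - P * Matrix.vecMulVec (Pi.single k 1) n := by
  simp [Amat, Tmat, mul_sub]

theorem vecMulVec_mul_eq_zero (hn : Matrix.vecMul n P = 0) (v : Fin N → 𝕜) :
    Matrix.vecMulVec v n * P = 0 := by
  rw [Matrix.vecMulVec_mul, hn, Matrix.vecMulVec_zero]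

theorem Amat_mul_self (hn : Matrix.vecMul n P = 0) (k : Fin N) :
    Amat P n k * P = n k • (P * P) := by
  rw [Amat_eq, sub_mul, mul_assoc, vecMulVec_mul_eq_zero hn, mul_zero, sub_zero, smul_mul_assoc]

theorem commutator_Amat (hn : Matrix.vecMul n P = 0) (j k : Fin N) :
    Amat P n j * Amat P n k - Amat P n k * Amat P n j =
      P ^ 2 * (n k • Matrix.vecMulVec (Pi.single j 1) n -
        n j • Matrix.vecMulVec (Pi.single k 1) n) := by
  have h (a b : Fin N) : Amat P n a * Amat P n b =
      (n a * n b) • P ^ 2 - n a • (P ^ 2 * Matrix.vecMulVec (Pi.single b 1) n) := by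
    conv_lhs => rw [Amat_eq b]
    rw [mul_sub, mul_smul_comm, ← mul_assoc, Amat_mul_self hn, smul_mul_assoc, smul_smul,
      mul_comm (n b), pow_two]
  rw [h, h, mul_comm (n k), mul_sub, mul_smul_comm, mul_smul_comm]
  abel

theorem nestedComm_Amat_pow_mul (hn : Matrix.vecMul n P = 0) {W : Matrix (Fin N) (Fin N) 𝕜}
    (hW : W * P = 0) (is : List (Fin N)) (m : ℕ) :
    nestedComm (Amat P n) is (P ^ (m + 1) * W) =
      P ^ (m + 1 + is.length) * ((is.map n).prod • W) := by
  induction is generalizing m W with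
  | nil => simp [nestedComm]
  | cons i is ih =>
    have hstep : Amat P n i * (P ^ (m + 1) * W) - P ^ (m + 1) * W * Amat P n i =
        P ^ (m + 1 + 1) * (n i • W) := by
      have hr : W * Amat P n i = 0 := by rw [Amat, ← mul_assoc, hW, zero_mul]
      rw [mul_assoc (P ^ (m + 1)), hr, mul_zero, sub_zero, pow_succ', ← mul_assoc, ← mul_assoc,
        Amat_mul_self hn, smul_mul_assoc, smul_mul_assoc, mul_smul_comm, mul_assoc P P,
        ← pow_succ', ← pow_succ']
    have hcons : nestedComm (Amat P n) (i :: is) (P ^ (m + 1) * W) =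
        nestedComm (Amat P n) is (P ^ (m + 1 + 1) * (n i • W)) := by
      rw [← hstep]
      rfl
    rw [hcons, ih (by rw [smul_mul_assoc, hW, smul_zero]), smul_smul, List.map_cons,
      List.prod_cons, mul_comm (n i), List.length_cons, add_right_comm (m + 1), add_assoc (m + 1)]

end

/-- If `P` is strictly upper triangular, then every nested commutator of depth `L` with
`L + 2 ≥ N` vanishes: the lower central series terminates. -/
theorem stmt10 {𝕜 : Type*} [RCLike 𝕜] {N : ℕ} (P : Matrix (Fin N) (Fin N) 𝕜)
    (n : Fin N → 𝕜) (hn : Matrix.vecMul n P = 0)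
    (hP : ∀ i j : Fin N, j ≤ i → P i j = 0)
    (is : List (Fin N)) (hL : N ≤ is.length + 2) (j k : Fin N) :
    nestedComm (Amat P n) is (Amat P n j * Amat P n k - Amat P n k * Amat P n j) = 0 := by
  rw [commutator_Amat hn, nestedComm_Amat_pow_mul hn (m := 1),
    pow_eq_zero_of_strictUpper hP (by omega), zero_mul]
  rw [sub_mul, smul_mul_assoc, smul_mul_assoc, vecMulVec_mul_eq_zero hn,
    vecMulVec_mul_eq_zero hn, smul_zero, smul_zero, sub_zero]
end
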